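/- arXiv:0705.0992 — 2 statements merged into one kernel-verified Lean document; each statement's English description precedes it below -/
import Mathlib

section
/- Let f be a pure state on a von Neumann algebra M. Then f is both normal and multiplicative on M if and only if there exists a minimal projection p in M that is central in M and satisfies f(p) = 1. -/
open scoped ComplexOrder InnerProductSpace
open Filter Topology

noncomputable instance {H : Type*} [NormedAddCommGroup H] [InnerProductSpace ℂ H]
    [CompleteSpace H] : SMulMemClass (VonNeumannAlgebra H) ℂ (H →L[ℂ] H) :=
  ⟨fun {s} c {_} hx => s.toStarSubalgebra.smul_mem hx c⟩

/-- The σ-weak (ultraweak, weak*) topology on `B(H)`: the initial topology induced by the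
functionals `x ↦ ∑' n, ⟪ξ n, x (η n)⟫` over all pairs of square-summable sequences. -/
noncomputable def sigmaWeak (H : Type*) [NormedAddCommGroup H] [InnerProductSpace ℂ H]
    [CompleteSpace H] : TopologicalSpace (H →L[ℂ] H) :=
  ⨅ (ξ : ℕ → H) (η : ℕ → H) (_ : Summable fun n => ‖ξ n‖ ^ 2)
    (_ : Summable fun n => ‖η n‖ ^ 2),
    TopologicalSpace.induced (fun x : H →L[ℂ] H => ∑' n, ⟪ξ n, x (η n)⟫_ℂ) inferInstance

variable {H : Type*} [NormedAddCommGroup H] [InnerProductSpace ℂ H] [CompleteSpace H]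

/-- A positive linear functional on a von Neumann algebra. -/
def IsPosFunctional (M : VonNeumannAlgebra H) (f : ↥M →ₗ[ℂ] ℂ) : Prop :=
  ∀ a : ↥M, 0 ≤ f (star a * a)

/-- A state on a von Neumann algebra: a positive linear functional sending `1` to `1`. -/
def IsStateOn (M : VonNeumannAlgebra H) (f : ↥M →ₗ[ℂ] ℂ) : Prop :=
  IsPosFunctional M f ∧ f 1 = 1

/-- A pure state: a state such that every positive linear functional it dominates is a
nonnegative scalar multiple of it. -/
def IsPureStateOn (M : VonNeumannAlgebra H) (f : ↥M →ₗ[ℂ] ℂ) : Prop :=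
  IsStateOn M f ∧ ∀ g : ↥M →ₗ[ℂ] ℂ, IsPosFunctional M g → IsPosFunctional M (f - g) →
    ∃ t : ℝ, 0 ≤ t ∧ g = (t : ℂ) • f

/-- A functional on a von Neumann algebra is normal if it is continuous for the σ-weak
topology. -/
def IsNormalOn (M : VonNeumannAlgebra H) (f : ↥M →ₗ[ℂ] ℂ) : Prop :=
  @Continuous ↥M ℂ
    (TopologicalSpace.induced (fun x : ↥M => (x : H →L[ℂ] H)) (sigmaWeak H)) _ f

/-- A state on a von Neumann algebra is singular if the only normal positive linear
functional it dominates is `0`. -/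
def IsSingularOn (M : VonNeumannAlgebra H) (f : ↥M →ₗ[ℂ] ℂ) : Prop :=
  ∀ g : ↥M →ₗ[ℂ] ℂ, IsPosFunctional M g → IsPosFunctional M (f - g) → IsNormalOn M g → g = 0

/-- A projection: a self-adjoint idempotent. -/
def IsProjection (p : H →L[ℂ] H) : Prop := star p = p ∧ p * p = p

/-- `q` is a subprojection of `p` (i.e. `q ≤ p` for projections). -/
def ProjLE (q p : H →L[ℂ] H) : Prop := q * p = q ∧ p * q = q

/-- `p` is a minimal projection of the set `S`: a nonzero projection in `S` such that the
only projections of `S` below `p` are `0` and `p`. -/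
def IsMinimalProjectionIn (S : Set (H →L[ℂ] H)) (p : H →L[ℂ] H) : Prop :=
  p ∈ S ∧ IsProjection p ∧ p ≠ 0 ∧
    ∀ q ∈ S, IsProjection q → ProjLE q p → q = 0 ∨ q = p

/-- `f` is multiplicative on the subset `C` of `M`. -/
def IsMultiplicativeOn (M : VonNeumannAlgebra H) (f : ↥M →ₗ[ℂ] ℂ)
    (C : Set (H →L[ℂ] H)) : Prop :=
  ∀ a b : ↥M, (a : H →L[ℂ] H) ∈ C → (b : H →L[ℂ] H) ∈ C → f (a * b) = f a * f b

/-- `f` is normal on the von Neumann subalgebra `C` of `M` (where `C ⊆ M`): the restriction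
of `f` to `C` is σ-weakly continuous. -/
def IsNormalOnSub (M : VonNeumannAlgebra H) (f : ↥M →ₗ[ℂ] ℂ) (C : VonNeumannAlgebra H)
    (hC : (C : Set (H →L[ℂ] H)) ⊆ M) : Prop :=
  @Continuous ↥C ℂ
    (TopologicalSpace.induced (fun x : ↥C => (x : H →L[ℂ] H)) (sigmaWeak H)) _
    (fun x => f ⟨x, hC x.2⟩)

/-- A state on `M` is classically normal if it is normal on every von Neumann subalgebra
of `M` (with the same unit) on which it is multiplicative. -/
def IsClassicallyNormalOn (M : VonNeumannAlgebra H) (f : ↥M →ₗ[ℂ] ℂ) : Prop :=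
  ∀ (C : VonNeumannAlgebra H) (hC : (C : Set (H →L[ℂ] H)) ⊆ M),
    IsMultiplicativeOn M f (C : Set (H →L[ℂ] H)) → IsNormalOnSub M f C hC

/-- A von Neumann algebra is a factor if its center consists of the scalar multiples of
the identity. -/
def IsFactor (N : VonNeumannAlgebra H) : Prop :=
  ∀ x ∈ N, (∀ y ∈ N, x * y = y * x) → ∃ c : ℂ, x = c • (1 : H →L[ℂ] H)

/-- A positive operator on a Hilbert space. -/
def IsPositiveOp (a : H →L[ℂ] H) : Prop :=
  star a = a ∧ ∀ v : H, 0 ≤ ⟪v, a v⟫_ℂ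

section Amplification

variable {ι : Type*}

/-- The coordinatewise action of a bounded operator on `ℓ²(ι, H)`. -/
noncomputable def amplify (x : H →L[ℂ] H) (w : lp (fun _ : ι => H) 2) : lp (fun _ : ι => H) 2 :=
  ⟨fun i => x (w i), by
    refine ((lp.memℓp w).norm.const_smul ‖x‖).mono fun i => ?_
    exact x.le_opNorm _⟩

lemma inner_amplify_left (x : H →L[ℂ] H) (v w : lp (fun _ : ι => H) 2) :
    ⟪amplify x v, w⟫_ℂ = ⟪v, amplify (star x) w⟫_ℂ := by
  simp only [lp.inner_eq_tsum]
  exact tsum_congr fun i => (ContinuousLinearMap.adjoint_inner_right x (v i) (w i)).symm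

lemma mem_closure_amplify_orbit {M : VonNeumannAlgebra H} {J : Submodule ℂ (H →L[ℂ] H)}
    (hJM : ∀ x ∈ J, x ∈ M) (hMJ : ∀ x ∈ M, ∀ y ∈ J, x * y ∈ J)
    (hker : ∀ v : H, (∀ x ∈ J, x v = 0) → v = 0) (η : lp (fun _ : ι => H) 2) :
    η ∈ closure {w | ∃ x ∈ J, amplify x η = w} := by
  let S : Submodule ℂ (lp (fun _ : ι => H) 2) :=
    { carrier := {w | ∃ x ∈ J, amplify x η = w}
      zero_mem' := ⟨0, J.zero_mem, rfl⟩
      add_mem' := by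
        rintro _ _ ⟨x, hx, rfl⟩ ⟨y, hy, rfl⟩
        exact ⟨x + y, J.add_mem hx hy, rfl⟩
      smul_mem' := by
        rintro c _ ⟨x, hx, rfl⟩
        exact ⟨c • x, J.smul_mem c hx, rfl⟩ }
  have horth : ∀ x ∈ M, ∀ w ∈ Sᗮ, amplify x w ∈ Sᗮ := by
    intro x hx w hw
    rw [Submodule.mem_orthogonal'] at hw ⊢
    rintro _ ⟨y, hy, rfl⟩
    rw [inner_amplify_left]
    exact hw _ ⟨star x * y, hMJ _ (star_mem hx) _ hy, rfl⟩
  let P := Sᗮ.starProjection η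
  have hP : P ∈ Sᗮ := Submodule.starProjection_apply_mem _ _
  have hQ : η - P ∈ Sᗮᗮ := Submodule.sub_starProjection_mem_orthogonal η
  have hamp : ∀ x ∈ J, amplify x P = 0 := by
    intro x hx
    have hxP := horth x (hJM x hx) P hP
    have h1 : ⟪amplify x P, amplify x η⟫_ℂ = 0 :=
      (Submodule.mem_orthogonal' _ _).1 hxP _ ⟨x, hx, rfl⟩
    have h2 : ⟪amplify x P, amplify x (η - P)⟫_ℂ = 0 := by
      have := (Submodule.mem_orthogonal _ _).1 hQ _ (horth _ (star_mem (hJM x hx)) _ hxP)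
      rwa [inner_amplify_left, star_star] at this
    have h3 : amplify x (η - P) = amplify x η - amplify x P := by
      ext i
      exact map_sub x _ _
    rw [h3, inner_sub_right, h1, zero_sub, neg_eq_zero] at h2
    exact inner_self_eq_zero.1 h2
  have hP0 : P = 0 := by
    ext i
    exact hker _ fun x hx => congrArg (fun w : lp (fun _ : ι => H) 2 => w i) (hamp x hx)
  rw [hP0, sub_zero, Submodule.orthogonal_orthogonal_eq_closure] at hQ
  exact hQ

end Amplification

/-- The index set of the functionals defining the σ-weak topology. -/
abbrev SqSummablePair (H : Type*) [NormedAddCommGroup H] : Type _ :=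
  {a : (ℕ → H) × (ℕ → H) // (Summable fun n => ‖a.1 n‖ ^ 2) ∧ Summable fun n => ‖a.2 n‖ ^ 2}

lemma sigmaWeak_eq_induced :
    sigmaWeak H = TopologicalSpace.induced
      (fun (x : H →L[ℂ] H) (a : SqSummablePair H) => ∑' n, ⟪a.1.1 n, x (a.1.2 n)⟫_ℂ)
      Pi.topologicalSpace := by
  rw [induced_to_pi, sigmaWeak, iInf_subtype, iInf_prod]
  simp_rw [iInf_and]

lemma memlp_prod_of_summable {E : Type*} [NormedAddCommGroup E] {α : Type*} [Finite α]
    (g : α → ℕ → E)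
    (hg : ∀ a, Summable fun n => ‖g a n‖ ^ 2) :
    Memℓp (fun i : α × ℕ => g i.1 i.2) 2 := by
  rw [memℓp_gen_iff (by norm_num)]
  simp only [ENNReal.toReal_ofNat, Real.rpow_two]
  rw [summable_prod_of_nonneg (fun _ => by positivity)]
  exact ⟨hg, Summable.of_finite⟩

lemma continuous_tsum_coord {E : Type*} [NormedAddCommGroup E] [InnerProductSpace ℂ E]
    {α : Type*} (ξ : α → ℕ → E)
    (hξ : ∀ a, Summable fun n => ‖ξ a n‖ ^ 2) (a : α) :
    Continuous fun w : lp (fun _ : α × ℕ => E) 2 => ∑' n, ⟪ξ a n, w (a, n)⟫_ℂ := by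
  classical
  have hinj : Function.Injective fun n : ℕ => (a, n) := fun _ _ h => (Prod.mk.inj h).2
  have hmem : Memℓp (fun i : α × ℕ => if i.1 = a then ξ a i.2 else 0) 2 := by
    rw [memℓp_gen_iff (by norm_num)]
    rw [← hinj.summable_iff]
    · simpa [Function.comp_def] using hξ a
    · rintro ⟨b, n⟩ hb
      have : b ≠ a := by rintro rfl; exact hb ⟨n, rfl⟩
      simp [this]
  let z : lp (fun _ : α × ℕ => E) 2 := ⟨_, hmem⟩
  have : (fun w : lp (fun _ : α × ℕ => E) 2 => ∑' n, ⟪ξ a n, w (a, n)⟫_ℂ) = fun w => ⟪z, w⟫_ℂ := by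
    ext w
    rw [lp.inner_eq_tsum, ← hinj.tsum_eq (f := fun i => ⟪z i, w i⟫_ℂ)]
    · simp [z]
    · rintro ⟨b, n⟩ hb
      by_contra h
      have : b ≠ a := by rintro rfl; exact h ⟨n, rfl⟩
      simp [z, this] at hb
  rw [this]
  fun_prop

/-- A left ideal of a von Neumann algebra with no common kernel contains `1` in its σ-weak closure. -/
lemma one_mem_sigmaWeak_closure {M : VonNeumannAlgebra H} {J : Submodule ℂ (H →L[ℂ] H)}
    (hJM : ∀ x ∈ J, x ∈ M) (hMJ : ∀ x ∈ M, ∀ y ∈ J, x * y ∈ J)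
    (hker : ∀ v : H, (∀ x ∈ J, x v = 0) → v = 0) :
    1 ∈ @closure _ (sigmaWeak H) (J : Set (H →L[ℂ] H)) := by
  rw [sigmaWeak_eq_induced, closure_induced, mem_closure_iff]
  intro o ho h1
  obtain ⟨s, u, hu, hs⟩ := isOpen_pi_iff.1 ho _ h1
  let η : lp (fun _ : s × ℕ => H) 2 :=
    ⟨fun i => i.1.1.1.2 i.2, memlp_prod_of_summable (fun a : s => a.1.1.2) fun a => a.1.2.2⟩
  let U : Set (lp (fun _ : s × ℕ => H) 2) :=
    ⋂ a : s, (fun w => ∑' n, ⟪a.1.1.1 n, w (a, n)⟫_ℂ) ⁻¹' u a.1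
  have hU : IsOpen U := isOpen_iInter_of_finite fun a =>
    (hu a.1 a.2).1.preimage
      (continuous_tsum_coord (fun a : s => a.1.1.1) (fun a => a.1.2.1) a)
  have hηU : η ∈ U := Set.mem_iInter.2 fun a => (hu a.1 a.2).2
  obtain ⟨_, hwU, x, hx, rfl⟩ :=
    mem_closure_iff.1 (mem_closure_amplify_orbit hJM hMJ hker η) U hU hηU
  exact ⟨_, hs fun a ha => Set.mem_iInter.1 hwU ⟨a, ha⟩, x, hx, rfl⟩

lemma starProjection_mem (M : VonNeumannAlgebra H) (K : Submodule ℂ H) [K.HasOrthogonalProjection]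
    (hK : ∀ y ∈ M.commutant, ∀ v ∈ K, y v ∈ K) : K.starProjection ∈ M := by
  rw [VonNeumannAlgebra.IsStarProjection.mem_iff isStarProjection_starProjection]
  intro y hy
  simpa [Module.End.mem_invtSubmodule_iff_forall_mem_of_mem] using hK y hy

section MinimalCentral

variable {M : VonNeumannAlgebra H} {p : H →L[ℂ] H}

lemma mul_eq_zero_of_apply_eq_zero (hp : IsMinimalProjectionIn (M : Set (H →L[ℂ] H)) p)
    (hc : ∀ x ∈ M, p * x = x * p) {b : H →L[ℂ] H} (hb : b ∈ M) {w : H} (hw : w ≠ 0)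
    (hpw : p w = w) (hbw : b w = 0) : b * p = 0 := by
  obtain ⟨hpM, ⟨hps, hpp⟩, -, hmin⟩ := hp
  have : CompleteSpace b.ker := b.isClosed_ker.completeSpace_coe
  let r := b.ker.starProjection
  have hr : IsStarProjection r := isStarProjection_starProjection
  have hrM : r ∈ M := by
    refine starProjection_mem M _ fun y hy v hv => ?_
    have h := DFunLike.congr_fun (VonNeumannAlgebra.mem_commutant_iff.1 hy b hb) v
    simp only [mul_apply_eq_comp, LinearMap.mem_ker, ContinuousLinearMap.coe_coe]
      at h hv ⊢
    rw [h, hv, map_zero]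
  have hpr := hc r hrM
  have hrr : r * r = r := hr.isIdempotentElem
  have hbr : b * r = 0 := by
    ext v
    exact LinearMap.mem_ker.1 (b.ker.starProjection_apply_mem v)
  have hrw : r w = w := b.ker.starProjection_eq_self_iff.2 hbw
  rcases hmin (r * p) (mul_mem hrM hpM)
    ⟨by rw [star_mul, hps, hr.isSelfAdjoint.star_eq, hpr],
      by rw [mul_assoc, ← mul_assoc p, hpr, mul_assoc, hpp, ← mul_assoc, hrr]⟩
    ⟨by rw [mul_assoc, hpp], by rw [← mul_assoc, hpr, mul_assoc, hpp]⟩ with h | h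
  · refine absurd ?_ hw
    have := DFunLike.congr_fun h w
    simpa [hpw, hrw] using this
  · rw [← h, ← mul_assoc, hbr, zero_mul]

lemma mul_eq_zero_or_of_mul_eq_zero (hp : IsMinimalProjectionIn (M : Set (H →L[ℂ] H)) p)
    (hc : ∀ x ∈ M, p * x = x * p) {x y : H →L[ℂ] H} (hx : x ∈ M) (hy : y ∈ M)
    (hxy : x * y = 0) : x * p = 0 ∨ y * p = 0 := by
  refine or_iff_not_imp_right.2 fun h => ?_
  obtain ⟨u, hu⟩ := DFunLike.exists_ne h
  refine mul_eq_zero_of_apply_eq_zero hp hc hx hu ?_ ?_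
  · rw [← mul_apply_eq_comp, ← mul_assoc, hc y hy, mul_assoc, hp.2.1.2]
  · rw [← mul_apply_eq_comp, ← mul_assoc, hxy]
    simp

lemma cfcₙ_real_mem (f : ℝ → ℝ) {b : H →L[ℂ] H} (hb : b ∈ M) : cfcₙ f b ∈ M := by
  rw [← M.commutant_commutant, VonNeumannAlgebra.mem_commutant_iff]
  intro y hy
  exact (Commute.cfcₙ_real (VonNeumannAlgebra.mem_commutant_iff.1 hy b hb) f).eq.symm

lemma apply_eq_zero_of_nonneg_of_inner_eq_zero {T : H →L[ℂ] H} (hT : 0 ≤ T) {v : H}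
    (h : ⟪v, T v⟫_ℂ = 0) : T v = 0 := by
  obtain ⟨S, rfl⟩ := CStarAlgebra.nonneg_iff_eq_star_mul_self.1 hT
  have h' : ⟪S v, S v⟫_ℂ = 0 := by
    rw [← h, mul_apply_eq_comp, ContinuousLinearMap.star_eq_adjoint,
      ContinuousLinearMap.adjoint_inner_right]
  rw [mul_apply_eq_comp, inner_self_eq_zero.1 h', map_zero]

lemma exists_mul_eq_smul_of_isSelfAdjoint (hp : IsMinimalProjectionIn (M : Set (H →L[ℂ] H)) p)
    (hc : ∀ x ∈ M, p * x = x * p) {a : H →L[ℂ] H} (ha : a ∈ M) (hsa : IsSelfAdjoint a) :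
    ∃ c : ℂ, a * p = c • p := by
  obtain ⟨u, hu⟩ := DFunLike.exists_ne hp.2.2.1
  let v := p u
  have hv : v ≠ 0 := hu
  have hpv : p v = v := DFunLike.congr_fun hp.2.1.2 u
  let t : ℝ := a.reApplyInnerSelf v / ‖v‖ ^ 2
  let b := a - (t : ℂ) • (1 : H →L[ℂ] H)
  have hbM : b ∈ M := sub_mem ha (SMulMemClass.smul_mem _ (one_mem M))
  have hb : IsSelfAdjoint b := by
    refine hsa.sub ?_
    simp [isSelfAdjoint_iff]
  have hbv : ⟪v, b v⟫_ℂ = 0 := by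
    have h1 : ⟪v, a v⟫_ℂ = (a.reApplyInnerSelf v : ℂ) :=
      (hsa.isSymmetric v v).symm.trans (hsa.isSymmetric.coe_reApplyInnerSelf_apply v).symm
    have h2 : (‖v‖ : ℂ) ≠ 0 := by simpa using hv
    simp only [b, t, sub_apply, smul_apply, one_apply_eq_self, inner_sub_right, inner_smul_right, h1,
      inner_self_eq_norm_sq_to_K]
    push_cast
    field_simp
    simp
  have hdecomp := CFC.posPart_sub_negPart b hb
  have hval : b⁺ v - b⁻ v = b v := DFunLike.congr_fun hdecomp v
  have hker : b v = 0 := by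
    rcases mul_eq_zero_or_of_mul_eq_zero hp hc (cfcₙ_real_mem _ hbM) (cfcₙ_real_mem _ hbM)
      (CFC.posPart_mul_negPart b) with h | h
    · have h0 : b⁺ v = 0 := by rw [← hpv]; exact DFunLike.congr_fun h v
      rw [h0, zero_sub] at hval
      rw [← hval, inner_neg_right, neg_eq_zero] at hbv
      rw [← hval, apply_eq_zero_of_nonneg_of_inner_eq_zero (CFC.negPart_nonneg b) hbv, neg_zero]
    · have h0 : b⁻ v = 0 := by rw [← hpv]; exact DFunLike.congr_fun h v
      rw [h0, sub_zero] at hval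
      rw [← hval] at hbv ⊢
      exact apply_eq_zero_of_nonneg_of_inner_eq_zero (CFC.posPart_nonneg b) hbv
  refine ⟨t, ?_⟩
  have := mul_eq_zero_of_apply_eq_zero hp hc hbM hv hpv hker
  rwa [sub_mul, smul_mul_assoc, one_mul, sub_eq_zero] at this

open scoped ComplexStarModule in
lemma exists_mul_eq_smul (hp : IsMinimalProjectionIn (M : Set (H →L[ℂ] H)) p)
    (hc : ∀ x ∈ M, p * x = x * p) {a : H →L[ℂ] H} (ha : a ∈ M) : ∃ c : ℂ, a * p = c • p := by
  have hre : (ℜ a : H →L[ℂ] H) ∈ M := by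
    rw [realPart_apply_coe, ← Complex.coe_smul]
    exact SMulMemClass.smul_mem _ (add_mem ha (star_mem ha))
  have him : (ℑ a : H →L[ℂ] H) ∈ M := by
    rw [imaginaryPart_apply_coe, ← Complex.coe_smul]
    exact SMulMemClass.smul_mem _ (SMulMemClass.smul_mem _ (sub_mem ha (star_mem ha)))
  obtain ⟨c, hcr⟩ := exists_mul_eq_smul_of_isSelfAdjoint hp hc hre (ℜ a).2
  obtain ⟨d, hd⟩ := exists_mul_eq_smul_of_isSelfAdjoint hp hc him (ℑ a).2
  refine ⟨c + Complex.I * d, ?_⟩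
  conv_lhs => rw [← realPart_add_I_smul_imaginaryPart a]
  rw [add_mul, smul_mul_assoc, hcr, hd, add_smul, mul_smul]

end MinimalCentral

lemma continuous_sigmaWeak_inner (v w : H) :
    @Continuous _ _ (sigmaWeak H) _ fun x : H →L[ℂ] H => ⟪v, x w⟫_ℂ := by
  have hs : ∀ u : H, Summable fun n : ℕ => ‖(Pi.single 0 u : ℕ → H) n‖ ^ 2 := fun u =>
    summable_of_ne_finset_zero (s := {0}) fun n hn => by
      simp [Pi.single_eq_of_ne (Finset.notMem_singleton.1 hn)]
  have heq : (fun x : H →L[ℂ] H => ⟪v, x w⟫_ℂ) = fun x =>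
      ∑' n, ⟪(Pi.single 0 v : ℕ → H) n, x ((Pi.single 0 w : ℕ → H) n)⟫_ℂ := by
    ext x
    rw [tsum_eq_single 0 fun n hn => by simp [Pi.single_eq_of_ne hn]]
    simp
  rw [heq, continuous_iff_le_induced]
  exact (iInf_le _ _).trans <| (iInf_le _ _).trans <| (iInf_le _ (hs v)).trans <|
    iInf_le _ (hs w)

/-- A pure state with `f p = 1` for a central projection `p` is supported on `p`. -/
lemma IsPureStateOn.apply_mul_eq {M : VonNeumannAlgebra H} {f : ↥M →ₗ[ℂ] ℂ}
    (hf : IsPureStateOn M f) {p : ↥M} (hps : star p = p) (hpp : p * p = p)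
    (hc : ∀ x : ↥M, p * x = x * p) (hfp : f p = 1) (x : ↥M) : f (x * p) = f x := by
  let g : ↥M →ₗ[ℂ] ℂ :=
    { toFun := fun x => f (x * p)
      map_add' := fun x y => by rw [add_mul, map_add]
      map_smul' := fun c x => by rw [smul_mul_assoc, map_smul, RingHom.id_apply] }
  have hg : IsPosFunctional M g := fun a => by
    have h : star a * a * p = star (a * p) * (a * p) := by
      rw [star_mul, hps, mul_assoc p, hc, ← mul_assoc (star a), mul_assoc _ p, hpp]
    simpa only [g, LinearMap.coe_mk, AddHom.coe_mk, h] using hf.1.1 (a * p)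
  have hfg : IsPosFunctional M (f - g) := fun a => by
    have h : star a * a - star a * a * p = star (a * (1 - p)) * (a * (1 - p)) := by
      have h1 : p * (star a * a) * p = star a * a * p := by rw [hc, mul_assoc, hpp]
      rw [star_mul, star_sub, star_one, hps]
      calc star a * a - star a * a * p
          = star a * a - star a * a * p - p * (star a * a) + p * (star a * a) * p := by
            rw [h1, hc]; abel
        _ = _ := by noncomm_ring
    have := hf.1.1 (a * (1 - p))
    rw [← h, map_sub] at this
    exact this
  obtain ⟨t, -, ht⟩ := hf.2 g hg hfg
  have ht1 : (t : ℂ) = 1 := by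
    have h1 : g 1 = f p := by simp [g]
    rw [ht, hfp, LinearMap.smul_apply, hf.1.2, smul_eq_mul, mul_one] at h1
    exact h1
  have := DFunLike.congr_fun ht x
  rwa [ht1, one_smul] at this

/-- A pure state `f` on a von Neumann algebra `M` is both normal and multiplicative on `M`
iff there is a minimal projection `p` of `M` which is central in `M` and has `f p = 1`. -/
theorem pure_state_normal_and_multiplicative_iff
    (M : VonNeumannAlgebra H) (f : ↥M →ₗ[ℂ] ℂ) (hf : IsPureStateOn M f) :
    (IsNormalOn M f ∧ IsMultiplicativeOn M f (M : Set (H →L[ℂ] H))) ↔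
      ∃ p : ↥M, IsMinimalProjectionIn (M : Set (H →L[ℂ] H)) (p : H →L[ℂ] H) ∧
        (∀ x ∈ M, (p : H →L[ℂ] H) * x = x * p) ∧ f p = 1 := by
  constructor
  · rintro ⟨hn, hm⟩
    have hmul : ∀ a b : ↥M, f (a * b) = f a * f b := fun a b => hm a b a.2 b.2
    let J : Submodule ℂ (H →L[ℂ] H) :=
      { carrier := {x | ∃ y : ↥M, f y = 0 ∧ (y : H →L[ℂ] H) = x}
        zero_mem' := ⟨0, map_zero f, rfl⟩
        add_mem' := by
          rintro _ _ ⟨x, hx, rfl⟩ ⟨y, hy, rfl⟩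
          exact ⟨x + y, by rw [map_add, hx, hy, add_zero], rfl⟩
        smul_mem' := by
          rintro c _ ⟨x, hx, rfl⟩
          exact ⟨c • x, by rw [map_smul, hx, smul_zero], rfl⟩ }
    have hJM : ∀ x ∈ J, x ∈ M := by
      rintro _ ⟨x, -, rfl⟩
      exact x.2
    have hMJ : ∀ x ∈ M, ∀ y ∈ J, x * y ∈ J := by
      rintro x hx _ ⟨y, hy, rfl⟩
      exact ⟨⟨x, hx⟩ * y, by rw [hmul, hy, mul_zero], rfl⟩
    have hJMr : ∀ x ∈ M, ∀ y ∈ J, y * x ∈ J := by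
      rintro x hx _ ⟨y, hy, rfl⟩
      exact ⟨y * ⟨x, hx⟩, by rw [hmul, hy, zero_mul], rfl⟩
    have hone : 1 ∉ @closure _ (sigmaWeak H) (J : Set (H →L[ℂ] H)) := by
      intro h1
      let _ : TopologicalSpace (H →L[ℂ] H) := sigmaWeak H
      let _ : TopologicalSpace ↥M :=
        TopologicalSpace.induced (fun x : ↥M => (x : H →L[ℂ] H)) (sigmaWeak H)
      have hcl : (1 : ↥M) ∈ closure {y : ↥M | f y = 0} := by
        rw [closure_induced]
        exact h1
      have hcf : Continuous f := hn
      have := (isClosed_singleton.preimage hcf).closure_subset (s := f ⁻¹' {0}) hcl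
      exact one_ne_zero (hf.1.2.symm.trans this)
    let K : Submodule ℂ H := ⨅ x : J, (x : H →L[ℂ] H).ker
    have hKmem : ∀ v, v ∈ K ↔ ∀ x ∈ J, x v = 0 := fun v => by
      simp [K, Submodule.mem_iInf]
    have hKc : IsClosed (K : Set H) := by
      simp only [K, Submodule.coe_iInf]
      exact isClosed_iInter fun x => (x : H →L[ℂ] H).isClosed_ker
    have : CompleteSpace K := hKc.completeSpace_coe
    have hpM : K.starProjection ∈ M := by
      refine starProjection_mem M K fun y hy v hv => (hKmem _).2 fun x hx => ?_
      have h := DFunLike.congr_fun (VonNeumannAlgebra.mem_commutant_iff.1 hy x (hJM x hx)) v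
      simp only [mul_apply_eq_comp] at h
      rw [h, (hKmem v).1 hv x hx, map_zero]
    have hpM' : K.starProjection ∈ M.commutant := by
      refine starProjection_mem _ K fun y hy v hv => (hKmem _).2 fun x hx => ?_
      rw [VonNeumannAlgebra.commutant_commutant] at hy
      exact (hKmem v).1 hv _ (hJMr y hy x hx)
    have hK0 : K ≠ ⊥ := fun h => hone <| one_mem_sigmaWeak_closure hJM hMJ fun v hv => by
      have := (hKmem v).2 hv
      rwa [h, Submodule.mem_bot] at this
    let p : ↥M := ⟨K.starProjection, hpM⟩
    have hp : IsStarProjection (p : H →L[ℂ] H) := isStarProjection_starProjection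
    have hp0 : (p : H →L[ℂ] H) ≠ 0 := fun h => hK0 <| by
      have := K.range_starProjection
      rw [show K.starProjection = 0 from h] at this
      simpa using this.symm
    have hmulp : ∀ x : ↥M, (x : H →L[ℂ] H) * p = f x • (p : H →L[ℂ] H) := by
      intro x
      have hx : ((x - f x • (1 : ↥M) : ↥M) : H →L[ℂ] H) ∈ J :=
        ⟨_, by rw [map_sub, map_smul, hf.1.2, smul_eq_mul, mul_one, sub_self], rfl⟩
      ext v
      have := (hKmem _).1 (K.starProjection_apply_mem v) _ hx
      exact sub_eq_zero.1 this
    refine ⟨p, ⟨hpM, ⟨hp.isSelfAdjoint, hp.isIdempotentElem⟩, hp0, ?_⟩,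
      fun x hx => (VonNeumannAlgebra.mem_commutant_iff.1 hpM' x hx).symm, ?_⟩
    · rintro q hq ⟨-, hqq⟩ ⟨hqp, -⟩
      have h := hmulp ⟨q, hq⟩
      have hfq : f ⟨q, hq⟩ * f ⟨q, hq⟩ = f ⟨q, hq⟩ := by
        rw [← hmul]
        exact congrArg f (Subtype.ext hqq)
      rcases IsIdempotentElem.iff_eq_zero_or_one.1 hfq with h0 | h0 <;> rw [h0] at h
      · left; simpa [hqp] using h
      · right; simpa [hqp] using h
    · have h := hmulp p
      have hpp : (p : H →L[ℂ] H) * p = p := hp.isIdempotentElem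
      rw [hpp] at h
      have h' : (1 - f p) • (p : H →L[ℂ] H) = 0 := by rw [sub_smul, one_smul, ← h, sub_self]
      exact (sub_eq_zero.1 ((smul_eq_zero.1 h').resolve_right hp0)).symm
  · rintro ⟨p, hp, hc, hfp⟩
    have hps : star p = p := Subtype.ext hp.2.1.1
    have hpp : p * p = p := Subtype.ext hp.2.1.2
    have hmulp : ∀ x : ↥M, x * p = f x • p := by
      intro x
      obtain ⟨c, hcx⟩ := exists_mul_eq_smul hp hc x.2
      have h : x * p = c • p := Subtype.ext hcx
      have h1 := hf.apply_mul_eq hps hpp (fun y => Subtype.ext (hc y y.2)) hfp x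
      rw [h, map_smul, hfp, smul_eq_mul, mul_one] at h1
      rw [h, h1]
    constructor
    · obtain ⟨u, hu⟩ := DFunLike.exists_ne hp.2.2.1
      let v := (p : H →L[ℂ] H) u
      have hv : v ≠ 0 := hu
      have hfx : ∀ x : ↥M, f x = ⟪v, (x : H →L[ℂ] H) v⟫_ℂ / ⟪v, v⟫_ℂ := by
        intro x
        have h : (x : H →L[ℂ] H) v = f x • v :=
          DFunLike.congr_fun (congrArg (Subtype.val : ↥M → H →L[ℂ] H) (hmulp x)) u
        rw [h, inner_smul_right, mul_div_cancel_right₀ _ (inner_self_ne_zero.2 hv)]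
      unfold IsNormalOn
      let _ : TopologicalSpace (H →L[ℂ] H) := sigmaWeak H
      let _ : TopologicalSpace ↥M :=
        TopologicalSpace.induced (fun x : ↥M => (x : H →L[ℂ] H)) (sigmaWeak H)
      have h := (continuous_sigmaWeak_inner v v).comp
        (continuous_induced_dom (f := fun x : ↥M => (x : H →L[ℂ] H)))
      rw [show (f : ↥M → ℂ) = _ from funext hfx]
      exact h.div_const _
    · intro a b _ _
      have h : f (a * b) • p = (f a * f b) • p := by
        rw [← hmulp, mul_assoc, hmulp b, mul_smul_comm, hmulp a, smul_smul, mul_comm]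
      have := congrArg f h
      simpa [hfp] using this
end

section
/- Let f be a pure state on a von Neumann algebra M and set K_f = {x ∈ M : f(x x* + x* x) = 0}, a hereditary *-subalgebra of M. Then f is singular if and only if every increasing approximate unit of K_f converges to 1 in the σ-weak (weak*) topology of M. -/
open scoped ComplexOrder InnerProductSpace
open Filter Topology

variable {H : Type*} [NormedAddCommGroup H] [InnerProductSpace ℂ H] [CompleteSpace H]

namespace SigmaWeak

/-- A norm-bounded family of operators has a weak limit along every ultrafilter. -/
theorem exists_weak_limit {ι : Type*} (U : Ultrafilter ι) (e : ι → H →L[ℂ] H)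
    (he : ∀ i, ‖e i‖ ≤ 1) :
    ∃ h : H →L[ℂ] H, ∀ v w : H, Tendsto (fun i => ⟪v, e i w⟫_ℂ) U (𝓝 ⟪v, h w⟫_ℂ) := by
  have bound : ∀ i v w, ‖⟪e i v, w⟫_ℂ‖ ≤ 1 * ‖v‖ * ‖w‖ := fun i v w =>
    (norm_inner_le_norm _ _).trans (by gcongr; exact (e i).le_of_opNorm_le (he i) v)
  have lim : ∀ v w : H, ∃ c : ℂ, Tendsto (fun i => ⟪e i v, w⟫_ℂ) U (𝓝 c) := by
    intro v w
    obtain ⟨c, -, hc⟩ := (isCompact_closedBall (0 : ℂ) (1 * ‖v‖ * ‖w‖)).ultrafilter_le_nhds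
      (U.map fun i => ⟪e i v, w⟫_ℂ) (by
        rw [le_principal_iff]
        exact mem_map.2 (univ_mem' fun i => mem_closedBall_zero_iff.2 (bound i v w)))
    exact ⟨c, hc⟩
  choose b hb using lim
  have hbound : ∀ v w, ‖b v w‖ ≤ 1 * ‖v‖ * ‖w‖ := fun v w =>
    le_of_tendsto (hb v w).norm (Eventually.of_forall fun i => bound i v w)
  let B : H →ₗ⋆[ℂ] H →ₗ[ℂ] ℂ := LinearMap.mk₂'ₛₗ _ _ b
    (fun v v' w => tendsto_nhds_unique (hb _ _)
      (by simpa [inner_add_left] using (hb v w).add (hb v' w)))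
    (fun c v w => tendsto_nhds_unique (hb _ _)
      (by simpa [inner_smul_left, mul_comm] using (hb v w).const_mul ((starRingEnd ℂ) c)))
    (fun v w w' => tendsto_nhds_unique (hb _ _)
      (by simpa [inner_add_right] using (hb v w).add (hb v w')))
    (fun c v w => tendsto_nhds_unique (hb _ _)
      (by simpa [inner_smul_right] using (hb v w).const_mul c))
  refine ⟨InnerProductSpace.continuousLinearMapOfBilin (B.mkContinuous₂ 1 hbound), fun v w => ?_⟩
  have key : ⟪InnerProductSpace.continuousLinearMapOfBilin (B.mkContinuous₂ 1 hbound) w, v⟫_ℂ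
      = b w v := InnerProductSpace.continuousLinearMapOfBilin_apply _ _ _
  rw [← inner_conj_symm, key]
  exact ((Complex.continuous_conj.tendsto _).comp (hb w v)).congr fun i => inner_conj_symm _ _

/-- On norm-bounded families, weak convergence implies σ-weak convergence. -/
theorem tendsto_of_weak {ι : Type*} {l : Filter ι} {e : ι → H →L[ℂ] H} {h : H →L[ℂ] H}
    (he : ∀ i, ‖e i‖ ≤ 1)
    (hlim : ∀ v w : H, Tendsto (fun i => ⟪v, e i w⟫_ℂ) l (𝓝 ⟪v, h w⟫_ℂ)) :
    Tendsto e l (@nhds _ (sigmaWeak H) h) := by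
  rw [sigmaWeak]
  simp only [nhds_iInf, nhds_induced, tendsto_iInf, tendsto_comap_iff]
  intro ξ η hξ hη
  refine tendsto_tsum_of_dominated_convergence (bound := fun n => ‖ξ n‖ ^ 2 + ‖η n‖ ^ 2)
    (hξ.add hη) (fun n => hlim _ _) (Eventually.of_forall fun i n => ?_)
  have h1 : ‖⟪ξ n, e i (η n)⟫_ℂ‖ ≤ ‖ξ n‖ * ‖η n‖ := (norm_inner_le_norm _ _).trans
    (by gcongr; simpa using (e i).le_of_opNorm_le (he i) (η n))
  nlinarith [sq_nonneg (‖ξ n‖ - ‖η n‖), sq_nonneg (‖ξ n‖), sq_nonneg (‖η n‖)]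

theorem continuous_inner_apply (v w : H) :
    @Continuous _ _ (sigmaWeak H) _ fun x : H →L[ℂ] H => ⟪v, x w⟫_ℂ := by
  have hs : ∀ u : H, Summable fun n : ℕ => ‖(Pi.single 0 u : ℕ → H) n‖ ^ 2 := fun u =>
    summable_of_ne_finset_zero (s := {0}) fun n hn => by
      simp [Pi.single_eq_of_ne (Finset.notMem_singleton.1 hn)]
  have h : (fun x : H →L[ℂ] H => ⟪v, x w⟫_ℂ) = fun x : H →L[ℂ] H =>
      ∑' n, ⟪(Pi.single 0 v : ℕ → H) n, x ((Pi.single 0 w : ℕ → H) n)⟫_ℂ := by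
    ext x
    rw [tsum_eq_single 0 fun n hn => by simp [Pi.single_eq_of_ne hn]]
    simp
  rw [h, sigmaWeak]
  refine continuous_iInf_dom (i := Pi.single 0 v) <| continuous_iInf_dom (i := Pi.single 0 w) <|
    continuous_iInf_dom (i := hs v) <| continuous_iInf_dom (i := hs w) continuous_induced_dom

end SigmaWeak

theorem ContinuousLinearMap.nonneg_iff_forall_inner {E : Type*} [NormedAddCommGroup E]
    [InnerProductSpace ℂ E] {a : E →L[ℂ] E} : 0 ≤ a ↔ ∀ v : E, 0 ≤ ⟪v, a v⟫_ℂ := by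
  rw [nonneg_iff_isPositive]
  refine ⟨fun h v => h.inner_nonneg_right v, fun h => (isPositive_iff_complex a).2 fun v => ?_⟩
  have hv := h v
  rw [← inner_conj_symm, starRingEnd_apply, star_nonneg_iff] at hv
  exact ⟨Complex.ext (by simp) (by simpa using (Complex.nonneg_iff.1 hv).2),
    (Complex.nonneg_iff.1 hv).1⟩

theorem isPositiveOp_iff_nonneg {a : H →L[ℂ] H} : IsPositiveOp a ↔ 0 ≤ a :=
  ⟨fun h => ContinuousLinearMap.nonneg_iff_forall_inner.2 h.2, fun h =>
    ⟨h.isSelfAdjoint.star_eq, ContinuousLinearMap.nonneg_iff_forall_inner.1 h⟩⟩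

theorem ContinuousLinearMap.nonneg_of_weak_limit {E : Type*} [NormedAddCommGroup E]
    [InnerProductSpace ℂ E] {ι : Type*} {l : Filter ι} [l.NeBot]
    {e : ι → E →L[ℂ] E} {h : E →L[ℂ] E} (he : ∀ᶠ i in l, 0 ≤ e i)
    (hlim : ∀ v w : E, Tendsto (fun i => ⟪v, e i w⟫_ℂ) l (𝓝 ⟪v, h w⟫_ℂ)) : 0 ≤ h :=
  nonneg_iff_forall_inner.2 fun v =>
    ge_of_tendsto (hlim v v) (he.mono fun _ hi => nonneg_iff_forall_inner.1 hi v)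

theorem ContinuousLinearMap.norm_le_one_of_nonneg_of_le_one {a : H →L[ℂ] H} (h0 : 0 ≤ a)
    (h1 : a ≤ 1) : ‖a‖ ≤ 1 :=
  (CStarAlgebra.norm_le_one_iff_of_nonneg a h0).2 h1

namespace VonNeumannAlgebra

/-- A von Neumann algebra is closed under weak limits. -/
theorem mem_of_weak_limit (M : VonNeumannAlgebra H) {ι : Type*} {l : Filter ι} [l.NeBot]
    {e : ι → H →L[ℂ] H} {h : H →L[ℂ] H} (he : ∀ i, e i ∈ M)
    (hlim : ∀ v w : H, Tendsto (fun i => ⟪v, e i w⟫_ℂ) l (𝓝 ⟪v, h w⟫_ℂ)) : h ∈ M := by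
  rw [← M.commutant_commutant, mem_commutant_iff]
  intro y hy
  refine ContinuousLinearMap.ext fun w => ext_inner_left ℂ fun v => ?_
  refine tendsto_nhds_unique ?_ (hlim v (y w))
  have := hlim (star y v) w
  simp only [ContinuousLinearMap.star_eq_adjoint, ContinuousLinearMap.adjoint_inner_left] at this
  refine this.congr fun i => ?_
  exact congrArg (fun z : H →L[ℂ] H => ⟪v, z w⟫_ℂ) (mem_commutant_iff.1 hy _ (he i)).symm

theorem exists_star_mul_self_eq (M : VonNeumannAlgebra H) {a : H →L[ℂ] H} (ha : a ∈ M)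
    (h0 : 0 ≤ a) : ∃ s ∈ M, star s * s = a := by
  refine ⟨CFC.sqrt a, ?_, ?_⟩
  · rw [← M.commutant_commutant, mem_commutant_iff]
    intro y hy
    have hc : Commute a y := mem_commutant_iff.1 hy a ha
    exact (hc.cfcₙ_nnreal _).symm
  · rw [(CFC.sqrt_nonneg a).isSelfAdjoint.star_eq, CFC.sqrt_mul_sqrt_self a]

/-- A chain of positive contractions has a least upper bound in the von Neumann algebra, which
is a weak limit of the chain. -/
theorem exists_sup_of_isChain (M : VonNeumannAlgebra H) {C : Set (H →L[ℂ] H)}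
    (hC : IsChain (· ≤ ·) C) (hne : C.Nonempty) (hM : ∀ x ∈ C, x ∈ M) (h0 : ∀ x ∈ C, 0 ≤ x)
    (h1 : ∀ x ∈ C, x ≤ 1) :
    ∃ h ∈ M, ∃ U : Ultrafilter C, (∀ x ∈ C, x ≤ h) ∧ (∀ b, (∀ x ∈ C, x ≤ b) → h ≤ b) ∧
      ∀ v w : H, Tendsto (fun x : C => ⟪v, (x : H →L[ℂ] H) w⟫_ℂ) U (𝓝 ⟪v, h w⟫_ℂ) := by
  have : Nonempty C := hne.to_subtype
  have : IsDirectedOrder C := ⟨fun x y => by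
    rcases hC.total x.2 y.2 with h | h
    exacts [⟨y, h, le_rfl⟩, ⟨x, le_rfl, h⟩]⟩
  let U : Ultrafilter C := Ultrafilter.of atTop
  have hU : (U : Filter C) ≤ atTop := Ultrafilter.of_le _
  obtain ⟨h, hh⟩ := SigmaWeak.exists_weak_limit U (fun x : C => (x : H →L[ℂ] H))
    fun x => ContinuousLinearMap.norm_le_one_of_nonneg_of_le_one (h0 x x.2) (h1 x x.2)
  refine ⟨h, M.mem_of_weak_limit (fun x : C => hM x x.2) hh, U, fun x hx => ?_, fun b hb => ?_, hh⟩
  · rw [← sub_nonneg]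
    refine ContinuousLinearMap.nonneg_of_weak_limit (l := (U : Filter C))
      (e := fun y : C => (y : H →L[ℂ] H) - x) ?_ fun v w => ?_
    · filter_upwards [hU (eventually_ge_atTop ⟨x, hx⟩)] with y hy using sub_nonneg.2 hy
    · simpa [inner_sub_right] using (hh v w).sub_const _
  · rw [← sub_nonneg]
    refine ContinuousLinearMap.nonneg_of_weak_limit (l := (U : Filter C))
      (e := fun y : C => b - (y : H →L[ℂ] H)) ?_ fun v w => ?_
    · exact Eventually.of_forall fun y => sub_nonneg.2 (hb y y.2)
    · simpa [inner_sub_right] using (hh v w).const_sub _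

end VonNeumannAlgebra

namespace IsPosFunctional

variable {M : VonNeumannAlgebra H} {f : ↥M →ₗ[ℂ] ℂ}

theorem apply_nonneg (hf : IsPosFunctional M f) {a : ↥M} (ha : 0 ≤ (a : H →L[ℂ] H)) :
    0 ≤ f a := by
  obtain ⟨s, hs, hsa⟩ := M.exists_star_mul_self_eq a.2 ha
  have e : a = star ⟨s, hs⟩ * ⟨s, hs⟩ := Subtype.ext hsa.symm
  rw [e]
  exact hf _

theorem apply_mono (hf : IsPosFunctional M f) {a b : ↥M}
    (hab : (a : H →L[ℂ] H) ≤ (b : H →L[ℂ] H)) : f a ≤ f b := by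
  rw [← sub_nonneg, ← map_sub]
  exact hf.apply_nonneg (sub_nonneg.2 hab)

theorem apply_star (hf : IsPosFunctional M f) (a : ↥M) :
    f (star a) = (starRingEnd ℂ) (f a) := by
  have h1 := (Complex.nonneg_iff.1 (hf 1)).2
  have ha := (Complex.nonneg_iff.1 (hf a)).2
  have h2 := (Complex.nonneg_iff.1 (hf (1 + a))).2
  have h3 := (Complex.nonneg_iff.1 (hf (1 + Complex.I • a))).2
  have e2 : star (1 + a) * (1 + a) = star 1 * 1 + a + star a + star a * a := by
    simp [add_mul, mul_add]; abel
  have e3 : star (1 + Complex.I • a) * (1 + Complex.I • a)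
      = star 1 * 1 + Complex.I • a - Complex.I • star a + star a * a := by
    simp [add_mul, mul_add, smul_smul]
    abel
  rw [e2] at h2
  rw [e3] at h3
  simp only [map_add, map_sub, map_smul, Complex.add_im, Complex.sub_im, smul_eq_mul,
    Complex.I_mul_im] at h2 h3
  apply Complex.ext
  · rw [Complex.conj_re]; linarith
  · rw [Complex.conj_im]; linarith

/-- The Cauchy–Schwarz inequality for positive functionals. -/
theorem norm_apply_star_mul_sq_le (hf : IsPosFunctional M f) (a b : ↥M) :
    ‖f (star a * b)‖ ^ 2 ≤ (f (star a * a)).re * (f (star b * b)).re := by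
  let core : PreInnerProductSpace.Core ℂ ↥M :=
    { inner := fun a b => f (star a * b)
      conj_inner_symm := fun a b => by
        rw [← hf.apply_star, star_mul, star_star]
      re_inner_nonneg := fun a => (Complex.nonneg_iff.1 (hf a)).1
      add_left := fun a b c => by simp [add_mul]
      smul_left := fun a b c => by simp }
  have h := @InnerProductSpace.Core.inner_mul_inner_self_le ℂ ↥M _ _ _ core a b
  have hs : ‖f (star b * a)‖ = ‖f (star a * b)‖ := by
    rw [← Complex.norm_conj, ← hf.apply_star, star_mul, star_star]
  change ‖f (star a * b)‖ * ‖f (star b * a)‖ ≤ _ at h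
  rw [hs] at h
  rw [sq]
  exact h

theorem apply_mul_eq_zero (hf : IsPosFunctional M f) {a : ↥M} (ha : f (star a * a) = 0) (b : ↥M) :
    f (b * a) = 0 := by
  have h := hf.norm_apply_star_mul_sq_le (star b) a
  rw [ha, star_star] at h
  simpa using h

end IsPosFunctional

theorem ContinuousLinearMap.mul_self_le_of_nonneg_of_le_one {k : H →L[ℂ] H} (h0 : 0 ≤ k)
    (h1 : k ≤ 1) : k * k ≤ k := by
  have hk := h0.isSelfAdjoint
  have h1' := sub_nonneg.2 h1
  have e : k - k * k = k * (1 - k) * k + (1 - k) * k * (1 - k) := by noncomm_ring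
  rw [← sub_nonneg, e]
  exact add_nonneg (hk.conjugate_nonneg h1') (h1'.isSelfAdjoint.conjugate_nonneg h0)

theorem ContinuousLinearMap.star_mul_self_inner (x : H →L[ℂ] H) (v : H) :
    ⟪v, (star x * x) v⟫_ℂ = (‖x v‖ : ℂ) ^ 2 := by
  rw [mul_apply_eq_comp, star_eq_adjoint, adjoint_inner_right, inner_self_eq_norm_sq_to_K]
  rfl

theorem ContinuousLinearMap.conjugate_le_of_nonneg_of_le_one (x : H →L[ℂ] H) {k : H →L[ℂ] H}
    (h0 : 0 ≤ k) (h1 : k ≤ 1) :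
    (((‖x‖ ^ 2 + 1)⁻¹ : ℝ) : ℂ) • (star (x * k) * (x * k)) ≤ k := by
  rw [← sub_nonneg, nonneg_iff_forall_inner]
  intro v
  have hk := nonneg_iff_forall_inner.1
    (sub_nonneg.2 (mul_self_le_of_nonneg_of_le_one h0 h1)) v
  have hkk : k * k = star k * k := by rw [h0.isSelfAdjoint.star_eq]
  rw [sub_apply, inner_sub_right, hkk, star_mul_self_inner] at hk
  rw [sub_apply, inner_sub_right, smul_apply, inner_smul_right, star_mul_self_inner]
  refine hk.trans (sub_le_sub_left ?_ _)
  norm_cast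
  rw [inv_mul_le_iff₀ (by positivity)]
  have hx : ‖x (k v)‖ ^ 2 ≤ (‖x‖ * ‖k v‖) ^ 2 := by
    gcongr
    exact x.le_opNorm _
  calc _ ≤ (‖x‖ * ‖k v‖) ^ 2 := hx
    _ ≤ _ := by nlinarith [sq_nonneg ‖k v‖]

/-- Below every nonzero positive contraction in `M` there is a nonzero element on the corner of
which a given positive functional is dominated by a vector functional. -/
theorem IsPosFunctional.exists_corner_le_vector {M : VonNeumannAlgebra H} {f : ↥M →ₗ[ℂ] ℂ}
    (hf : IsPosFunctional M f) {p : ↥M} (hp0 : 0 ≤ (p : H →L[ℂ] H)) (hp1 : (p : H →L[ℂ] H) ≤ 1)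
    (hp : (p : H →L[ℂ] H) ≠ 0) :
    ∃ k : ↥M, (k : H →L[ℂ] H) ≠ 0 ∧ 0 ≤ (k : H →L[ℂ] H) ∧ (k : H →L[ℂ] H) ≤ p ∧
      ∃ ζ : H, ∀ x : ↥M,
        (f (star (x * k) * (x * k))).re ≤ ‖(x : H →L[ℂ] H) ((k : H →L[ℂ] H) ζ)‖ ^ 2 := by
  obtain ⟨ζ, hζ⟩ : ∃ ζ : H, (f p).re < (⟪ζ, (p : H →L[ℂ] H) ζ⟫_ℂ).re := by
    have hnn := ContinuousLinearMap.nonneg_iff_forall_inner.1 hp0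
    obtain ⟨v, hv⟩ : ∃ v : H, 0 < (⟪v, (p : H →L[ℂ] H) v⟫_ℂ).re := by
      by_contra! hcon
      refine hp (le_antisymm ?_ hp0)
      rw [← neg_nonneg, ContinuousLinearMap.nonneg_iff_forall_inner]
      intro v
      have := Complex.nonneg_iff.1 (hnn v)
      rw [neg_apply, inner_neg_right, Complex.nonneg_iff]
      refine ⟨?_, ?_⟩
      · simpa using hcon v
      · simpa using this.2.symm
    obtain ⟨n, hn⟩ := exists_nat_gt ((f p).re / (⟪v, (p : H →L[ℂ] H) v⟫_ℂ).re)
    rw [div_lt_iff₀ hv] at hn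
    refine ⟨(n : ℂ) • v, hn.trans_le ?_⟩
    have hnn : (n : ℝ) ≤ n * n := by exact_mod_cast Nat.le_mul_self n
    have e : ⟪(n : ℂ) • v, (p : H →L[ℂ] H) ((n : ℂ) • v)⟫_ℂ
        = ((n * n : ℝ) : ℂ) * ⟪v, (p : H →L[ℂ] H) v⟫_ℂ := by
      simp only [map_smul, inner_smul_left, inner_smul_right, map_natCast]
      push_cast
      ring
    rw [e, Complex.re_ofReal_mul]
    gcongr
  let S : Set (H →L[ℂ] H) := {x | ∃ hx : x ∈ M, 0 ≤ x ∧ x ≤ p ∧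
    (⟪ζ, x ζ⟫_ℂ).re ≤ (f ⟨x, hx⟩).re}
  obtain ⟨m, -, hm⟩ := zorn_le_nonempty₀ S (fun C hCS hC y hy => by
    obtain ⟨h, hhM, U, hub, hlub, hlim⟩ := M.exists_sup_of_isChain hC ⟨y, hy⟩
      (fun x hx => (hCS hx).1) (fun x hx => (hCS hx).2.1)
      (fun x hx => (hCS hx).2.2.1.trans hp1)
    refine ⟨h, ⟨hhM, (hCS hy).2.1.trans (hub y hy), hlub _ fun x hx => (hCS hx).2.2.1, ?_⟩, hub⟩
    refine le_of_tendsto ((Complex.continuous_re.tendsto _).comp (hlim ζ ζ))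
      (Eventually.of_forall fun x => ?_)
    obtain ⟨hxM, -, -, hx⟩ := hCS x.2
    exact hx.trans (Complex.le_def.1
      (hf.apply_mono (a := ⟨x, hxM⟩) (b := ⟨h, hhM⟩) (hub x x.2))).1) 0
    ⟨zero_mem M, le_rfl, hp0, by
      have : (⟨0, zero_mem M⟩ : ↥M) = 0 := rfl
      simp [this]⟩
  obtain ⟨hmM, hm0, hmp, hmf⟩ := hm.prop
  refine ⟨p - ⟨m, hmM⟩, fun h => ?_, sub_nonneg.2 hmp, sub_le_self _ hm0, ζ, fun x => ?_⟩
  · have : (p : H →L[ℂ] H) = m := sub_eq_zero.1 h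
    have e : (⟨m, hmM⟩ : ↥M) = p := Subtype.ext this.symm
    rw [e, ← this] at hmf
    exact hζ.not_ge hmf
  · set k : ↥M := p - ⟨m, hmM⟩ with hk
    have hk0 : 0 ≤ (k : H →L[ℂ] H) := sub_nonneg.2 hmp
    have hk1 : (k : H →L[ℂ] H) ≤ 1 := (sub_le_self _ hm0).trans hp1
    set c : ℝ := (‖(x : H →L[ℂ] H)‖ ^ 2 + 1)⁻¹ with hc
    have hc0 : 0 < c := by positivity
    let r : ↥M := (c : ℂ) • (star (x * k) * (x * k))
    have hrk : (r : H →L[ℂ] H) ≤ k :=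
      ContinuousLinearMap.conjugate_le_of_nonneg_of_le_one (x : H →L[ℂ] H) hk0 hk1
    have hrζ : ⟪ζ, (r : H →L[ℂ] H) ζ⟫_ℂ
        = ((c * ‖(x : H →L[ℂ] H) ((k : H →L[ℂ] H) ζ)‖ ^ 2 : ℝ) : ℂ) := by
      change ⟪ζ, ((c : ℂ) • (star (x * k : H →L[ℂ] H) * (x * k : H →L[ℂ] H))) ζ⟫_ℂ = _
      rw [smul_apply, inner_smul_right,
        ContinuousLinearMap.star_mul_self_inner]
      push_cast
      rfl
    have hr0 : 0 ≤ (r : H →L[ℂ] H) := by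
      change 0 ≤ (c : ℂ) • (star (x * k : H →L[ℂ] H) * (x * k : H →L[ℂ] H))
      exact smul_nonneg (by exact_mod_cast hc0.le) (star_mul_self_nonneg _)
    by_contra! hlt
    have hfr : (⟪ζ, (r : H →L[ℂ] H) ζ⟫_ℂ).re < (f r).re := by
      rw [hrζ, Complex.ofReal_re, map_smul, smul_eq_mul, Complex.re_ofReal_mul]
      gcongr
    have hmem : m + r ∈ S := by
      refine ⟨add_mem hmM r.2, add_nonneg hm0 hr0, ?_, ?_⟩
      · calc m + (r : H →L[ℂ] H) ≤ m + k := by gcongr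
          _ = p := by simp [hk]
      · have e : (⟨m + r, add_mem hmM r.2⟩ : ↥M) = ⟨m, hmM⟩ + r := rfl
        rw [e, map_add, add_apply, inner_add_right, Complex.add_re,
          Complex.add_re]
        linarith
    have hle := hm.le_of_ge hmem (le_add_of_nonneg_right hr0)
    have hr : (r : H →L[ℂ] H) = 0 := le_antisymm (by simpa using hle) hr0
    have hr' : r = 0 := Subtype.ext hr
    simp [hr'] at hfr

/-- The vector functional `x ↦ ⟪η, x η⟫` on a von Neumann algebra. -/
noncomputable def vectorFunctional (M : VonNeumannAlgebra H) (η : H) : ↥M →ₗ[ℂ] ℂ where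
  toFun x := ⟪η, (x : H →L[ℂ] H) η⟫_ℂ
  map_add' x y := by simp
  map_smul' c x := by simp

theorem vectorFunctional_star_mul_self (M : VonNeumannAlgebra H) (η : H) (x : ↥M) :
    vectorFunctional M η (star x * x) = ((‖(x : H →L[ℂ] H) η‖ ^ 2 : ℝ) : ℂ) := by
  rw [Complex.ofReal_pow]
  exact ContinuousLinearMap.star_mul_self_inner _ _

theorem isPosFunctional_vectorFunctional (M : VonNeumannAlgebra H) (η : H) :
    IsPosFunctional M (vectorFunctional M η) := fun x => by
  rw [vectorFunctional_star_mul_self]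
  exact Complex.zero_le_real.2 (sq_nonneg _)

theorem isNormalOn_vectorFunctional (M : VonNeumannAlgebra H) (η : H) :
    IsNormalOn M (vectorFunctional M η) :=
  @Continuous.comp _ _ _ (_) (sigmaWeak H) _ _ _
    (SigmaWeak.continuous_inner_apply η η) continuous_induced_dom

/-- If a linear functional on a space `V` is dominated by the norm of a linear map `T : V → H`,
then it is represented by a vector in the closure of the range of `T`. -/
theorem exists_inner_eq_of_norm_le {V : Type*} [AddCommGroup V] [Module ℂ V] (T : V →ₗ[ℂ] H)
    (φ : V →ₗ[ℂ] ℂ) (C : ℝ) (hφ : ∀ x, ‖φ x‖ ≤ C * ‖T x‖) :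
    ∃ η ∈ T.range.topologicalClosure, ∀ x, ⟪η, T x⟫_ℂ = φ x := by
  have hker : T.ker ≤ φ.ker := fun x hx => by
    have := hφ x
    rw [LinearMap.mem_ker.1 hx] at this
    simpa using this
  let ψ : T.range →ₗ[ℂ] ℂ := (T.ker.liftQ φ hker).comp T.quotKerEquivRange.symm.toLinearMap
  have hψ : ∀ x, ψ ⟨T x, LinearMap.mem_range_self T x⟩ = φ x := fun x => by
    change T.ker.liftQ φ hker (T.quotKerEquivRange.symm _) = _
    rw [LinearMap.quotKerEquivRange_symm_apply_image]
    simp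
  obtain ⟨Φ, hΦ, -⟩ := exists_extension_norm_eq T.range (ψ.mkContinuous C (by
    rintro ⟨_, x, rfl⟩
    exact (congrArg norm (hψ x)).trans_le (hφ x)))
  have : CompleteSpace T.range.topologicalClosure :=
    T.range.isClosed_topologicalClosure.completeSpace_coe
  refine ⟨T.range.topologicalClosure.starProjection ((InnerProductSpace.toDual ℂ H).symm Φ),
    Submodule.starProjection_apply_mem _ _, fun x => ?_⟩
  rw [Submodule.inner_starProjection_left_eq_right, Submodule.starProjection_eq_self_iff.2
    (T.range.le_topologicalClosure (LinearMap.mem_range_self T x)),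
    InnerProductSpace.toDual_symm_apply]
  exact (hΦ ⟨T x, LinearMap.mem_range_self T x⟩).trans (hψ x)

/-- A singular functional vanishes on every corner on which it is dominated by a vector
functional. -/
theorem IsSingularOn.apply_star_mul_self_eq_zero {M : VonNeumannAlgebra H} {f : ↥M →ₗ[ℂ] ℂ}
    (hf : IsPosFunctional M f) (hsing : IsSingularOn M f) {k : ↥M} {ζ : H}
    (hk : ∀ x : ↥M, (f (star (x * k) * (x * k))).re ≤ ‖(x : H →L[ℂ] H) ζ‖ ^ 2) :
    f (star k * k) = 0 := by
  let T : ↥M →ₗ[ℂ] H :=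
    { toFun := fun x => (x : H →L[ℂ] H) ζ
      map_add' := fun x y => rfl
      map_smul' := fun c x => rfl }
  let φ : ↥M →ₗ[ℂ] ℂ := f.comp (LinearMap.mulRight ℂ k)
  have hbound : ∀ x y : ↥M, ‖φ (star x * y)‖ ≤ √(f (star x * x)).re * ‖T y‖ := by
    intro x y
    have h1 := hf.norm_apply_star_mul_sq_le x (y * k)
    have h0 := (Complex.nonneg_iff.1 (hf x)).1
    have h2 := h1.trans (mul_le_mul_of_nonneg_left (hk y) h0)
    have e : φ (star x * y) = f (star x * (y * k)) := congrArg f (mul_assoc _ _ _)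
    rw [e]
    refine le_of_sq_le_sq ?_ (by positivity)
    rwa [mul_pow, Real.sq_sqrt h0]
  obtain ⟨η, hηT, hη⟩ := exists_inner_eq_of_norm_le T φ _ fun y => by
    simpa using hbound 1 y
  have hxη : ∀ x : ↥M, ‖(x : H →L[ℂ] H) η‖ ^ 2 ≤ (f (star x * x)).re := by
    intro x
    have hmaps : (x : H →L[ℂ] H) η ∈ closure (T.range : Set H) := by
      refine map_mem_closure (x : H →L[ℂ] H).continuous hηT ?_
      rintro _ ⟨y, rfl⟩
      exact ⟨x * y, rfl⟩
    have hcl : ∀ w ∈ closure (T.range : Set H),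
        ‖⟪(x : H →L[ℂ] H) η, w⟫_ℂ‖ ≤ √(f (star x * x)).re * ‖w‖ := by
      intro w hw
      refine closure_minimal ?_ (isClosed_le
        (f := fun w => ‖⟪(x : H →L[ℂ] H) η, w⟫_ℂ‖) (g := fun w => √(f (star x * x)).re * ‖w‖)
        (by fun_prop) (by fun_prop)) hw
      rintro _ ⟨y, rfl⟩
      have e : ⟪(x : H →L[ℂ] H) η, T y⟫_ℂ = φ (star x * y) := by
        rw [← hη, ← ContinuousLinearMap.adjoint_inner_right]
        rfl
      exact (congrArg norm e).trans_le (hbound x y)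
    have h := hcl _ hmaps
    rw [← inner_self_re_eq_norm, inner_self_eq_norm_mul_norm] at h
    have h0 := (Complex.nonneg_iff.1 (hf x)).1
    have hle : ‖(x : H →L[ℂ] H) η‖ ≤ √(f (star x * x)).re := by
      by_contra! hlt
      exact h.not_gt (mul_lt_mul_of_pos_right hlt ((Real.sqrt_nonneg _).trans_lt hlt))
    calc _ ≤ √(f (star x * x)).re ^ 2 := by gcongr
      _ = _ := Real.sq_sqrt h0
  have hzero := hsing (vectorFunctional M η) (isPosFunctional_vectorFunctional M η) (fun x => by
    have h0 := Complex.nonneg_iff.1 (hf x)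
    rw [LinearMap.sub_apply, vectorFunctional_star_mul_self, Complex.nonneg_iff]
    refine ⟨?_, by rw [Complex.sub_im, Complex.ofReal_im, sub_zero, ← h0.2]⟩
    rw [Complex.sub_re, Complex.ofReal_re]
    linarith [hxη x]) (isNormalOn_vectorFunctional M η)
  have hη0 : η = 0 := by
    have h : ⟪η, η⟫_ℂ = 0 := LinearMap.congr_fun hzero 1
    exact inner_self_eq_zero.1 h
  have h := hη (star k)
  rw [hη0, inner_zero_left] at h
  exact h.symm

/-- Approximate units of the kernel algebra of a singular positive
functional converge to `1`. -/
theorem IsSingularOn.tendsto_one {M : VonNeumannAlgebra H} {f : ↥M →ₗ[ℂ] ℂ}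
    (hf : IsPosFunctional M f) (hsing : IsSingularOn M f) {ι : Type*} {l : Filter ι} {e : ι → ↥M}
    (he0 : ∀ i, 0 ≤ (e i : H →L[ℂ] H)) (he1 : ∀ i, ‖(e i : H →L[ℂ] H)‖ ≤ 1)
    (hea : ∀ a : ↥M, f (a * star a + star a * a) = 0 →
      Tendsto (fun i => ‖(e i : H →L[ℂ] H) * a - (a : H →L[ℂ] H)‖) l (𝓝 0)) :
    Tendsto (fun i => (e i : H →L[ℂ] H)) l (@nhds _ (sigmaWeak H) 1) := by
  rw [tendsto_iff_ultrafilter]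
  intro U hU
  obtain ⟨h, hh⟩ := SigmaWeak.exists_weak_limit U (fun i => (e i : H →L[ℂ] H)) he1
  have hM : h ∈ M := M.mem_of_weak_limit (fun i => (e i).2) hh
  suffices hone : h = 1 from hone ▸ SigmaWeak.tendsto_of_weak he1 hh
  have hh0 : 0 ≤ h :=
    ContinuousLinearMap.nonneg_of_weak_limit (Eventually.of_forall he0) hh
  have hh1 : 0 ≤ 1 - h := ContinuousLinearMap.nonneg_of_weak_limit (l := (U : Filter ι))
    (e := fun i => 1 - (e i : H →L[ℂ] H))
    (Eventually.of_forall fun i =>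
      sub_nonneg.2 ((CStarAlgebra.norm_le_one_iff_of_nonneg _ (he0 i)).1 (he1 i)))
    fun v w => by simpa [inner_sub_right] using (hh v w).const_sub _
  by_contra hne
  obtain ⟨k, hk, hk0, hkp, ζ, hζ⟩ := hf.exists_corner_le_vector (p := 1 - ⟨h, hM⟩)
    hh1 (sub_le_self _ hh0) (fun h0 => hne (sub_eq_zero.1 h0).symm)
  have hkk := hsing.apply_star_mul_self_eq_zero hf hζ
  have hstar : star k = k := Subtype.ext hk0.isSelfAdjoint.star_eq
  have hlim := (hea k (by
    rw [hstar] at hkk ⊢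
    rw [map_add, hkk, add_zero])).mono_left hU
  have hhk : h * (k : H →L[ℂ] H) = k := by
    refine ContinuousLinearMap.ext fun w => ext_inner_left ℂ fun v => ?_
    refine tendsto_nhds_unique (hh v ((k : H →L[ℂ] H) w)) ?_
    have h1 : Tendsto (fun i => (e i : H →L[ℂ] H) * (k : H →L[ℂ] H)) U
        (𝓝 (k : H →L[ℂ] H)) := tendsto_iff_norm_sub_tendsto_zero.2 hlim
    have hc : Continuous fun x : H →L[ℂ] H => ⟪v, x w⟫_ℂ := by fun_prop
    exact (hc.tendsto _).comp h1
  have hcube : (k : H →L[ℂ] H) * k * k = 0 := by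
    refine le_antisymm ?_ (hk0.isSelfAdjoint.conjugate_nonneg hk0)
    calc (k : H →L[ℂ] H) * k * k ≤ k * (1 - h) * k := hk0.isSelfAdjoint.conjugate_le_conjugate hkp
      _ = 0 := by rw [mul_assoc, sub_mul, hhk, one_mul, sub_self, mul_zero]
  have hsq : (k : H →L[ℂ] H) * k = 0 := by
    have hs : star ((k : H →L[ℂ] H) * k) = k * k := by
      rw [star_mul, hk0.isSelfAdjoint.star_eq]
    rw [← CStarRing.star_mul_self_eq_zero_iff, hs, ← mul_assoc, hcube, zero_mul]
  refine hk ?_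
  rwa [← CStarRing.star_mul_self_eq_zero_iff, hk0.isSelfAdjoint.star_eq]

theorem IsNormalOn.tendsto_of_sigmaWeak {M : VonNeumannAlgebra H} {f : ↥M →ₗ[ℂ] ℂ}
    (hn : IsNormalOn M f) {ι : Type*} {l : Filter ι} {e : ι → ↥M} {h : ↥M}
    (he : Tendsto (fun i => (e i : H →L[ℂ] H)) l (@nhds _ (sigmaWeak H) h)) :
    Tendsto (fun i => f (e i)) l (𝓝 (f h)) := by
  have h1 : Tendsto e l (@nhds ↥M
      (TopologicalSpace.induced (fun x : ↥M => (x : H →L[ℂ] H)) (sigmaWeak H)) h) := by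
    rw [@nhds_induced _ _ (sigmaWeak H), tendsto_comap_iff]
    exact he
  exact (@Continuous.tendsto _ _ (_) _ _ hn h).comp h1

/-- The kernel algebra of a normal positive functional has a unit. -/
theorem IsNormalOn.exists_unit_of_kernel {M : VonNeumannAlgebra H} {f : ↥M →ₗ[ℂ] ℂ}
    (hf : IsPosFunctional M f) (hn : IsNormalOn M f) :
    ∃ h : ↥M, 0 ≤ (h : H →L[ℂ] H) ∧ (h : H →L[ℂ] H) ≤ 1 ∧ star h = h ∧ h * h = h ∧ f h = 0 ∧
      ∀ a : ↥M, f (star a * a) = 0 → a * h = a := by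
  let S : Set (H →L[ℂ] H) := {x | ∃ hx : x ∈ M, 0 ≤ x ∧ x ≤ 1 ∧ f ⟨x, hx⟩ = 0}
  obtain ⟨m, -, hm⟩ := zorn_le_nonempty₀ S (fun C hCS hC y hy => by
    obtain ⟨h, hhM, U, hub, hlub, hlim⟩ := M.exists_sup_of_isChain hC ⟨y, hy⟩
      (fun x hx => (hCS hx).1) (fun x hx => (hCS hx).2.1) (fun x hx => (hCS hx).2.2.1)
    refine ⟨h, ⟨hhM, (hCS hy).2.1.trans (hub y hy), hlub _ fun x hx => (hCS hx).2.2.1, ?_⟩, hub⟩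
    have hσ := SigmaWeak.tendsto_of_weak (l := (U : Filter C))
      (fun x : C => ContinuousLinearMap.norm_le_one_of_nonneg_of_le_one
        (hCS x.2).2.1 (hCS x.2).2.2.1) hlim
    have hf' := hn.tendsto_of_sigmaWeak (e := fun x : C => ⟨x, (hCS x.2).1⟩) (h := ⟨h, hhM⟩) hσ
    refine tendsto_nhds_unique hf' (tendsto_const_nhds.congr fun x => ?_)
    exact (hCS x.2).2.2.2.symm) 0 ⟨zero_mem M, le_rfl, zero_le_one, map_zero f⟩
  obtain ⟨hmM, hm0, hm1, hmf⟩ := hm.prop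
  set h : ↥M := ⟨m, hmM⟩ with hh
  have hstar : star h = h := Subtype.ext hm0.isSelfAdjoint.star_eq
  have hsq : f (h * h) = 0 := by
    refine le_antisymm ?_ (by simpa [hstar] using hf h)
    rw [← hmf]
    exact hf.apply_mono (ContinuousLinearMap.mul_self_le_of_nonneg_of_le_one hm0 hm1)
  have hmax : ∀ r : ↥M, 0 ≤ (r : H →L[ℂ] H) → (r : H →L[ℂ] H) ≤ 1 - m → f r = 0 → r = 0 := by
    intro r hr0 hr1 hr
    have hle := hm.le_of_ge (y := m + r) ⟨add_mem hmM r.2, add_nonneg hm0 hr0,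
      by simpa using add_le_add_right hr1 m, by
        have e : (⟨m + r, add_mem hmM r.2⟩ : ↥M) = h + r := rfl
        rw [e, map_add, hmf, hr, add_zero]⟩ (le_add_of_nonneg_right hr0)
    exact Subtype.ext (le_antisymm (by simpa using hle) hr0)
  have hidem : h * h = h := by
    have hr := hmax (h - h * h)
      (sub_nonneg.2 (ContinuousLinearMap.mul_self_le_of_nonneg_of_le_one hm0 hm1)) (by
        rw [← sub_nonneg]
        have e : 1 - m - ((h - h * h : ↥M) : H →L[ℂ] H) = star (1 - m) * (1 - m) := by
          rw [star_sub, star_one, hm0.isSelfAdjoint.star_eq]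
          change 1 - m - (m - m * m) = _
          noncomm_ring
        rw [e]
        exact star_mul_self_nonneg _) (by rw [map_sub, hsq, hmf, sub_zero])
    exact (sub_eq_zero.1 hr).symm
  refine ⟨h, hm0, hm1, hstar, hidem, hmf, fun a ha => ?_⟩
  have hk0 : 0 ≤ 1 - m := sub_nonneg.2 hm1
  let b : ↥M := a * (1 - h)
  have hb : f (star b * b) = 0 := by
    have e : star b * b = (1 - h) * star a * a - (1 - h) * star a * a * h := by
      simp only [b, star_mul, star_sub, star_one, hstar]
      noncomm_ring
    rw [e, map_sub, hf.apply_mul_eq_zero ha, hf.apply_mul_eq_zero (by rwa [hstar]), sub_zero]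
  have hr := hmax ((((‖(a : H →L[ℂ] H)‖ ^ 2 + 1)⁻¹ : ℝ) : ℂ) • (star b * b))
    (smul_nonneg (by exact_mod_cast (by positivity)) (star_mul_self_nonneg (b : H →L[ℂ] H)))
    (ContinuousLinearMap.conjugate_le_of_nonneg_of_le_one (a : H →L[ℂ] H) hk0
      (sub_le_self _ hm0)) (by rw [map_smul, hb, smul_zero])
  have hc : (((‖(a : H →L[ℂ] H)‖ ^ 2 + 1)⁻¹ : ℝ) : ℂ) ≠ 0 := by
    exact_mod_cast (by positivity)
  have hbb : star b * b = 0 := (smul_eq_zero.1 hr).resolve_left hc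
  have hb0 : b = 0 := Subtype.ext
    ((CStarRing.star_mul_self_eq_zero_iff (b : H →L[ℂ] H)).1 (congrArg Subtype.val hbb))
  have : a - a * h = 0 := by rw [← hb0]; simp only [b]; noncomm_ring
  exact (sub_eq_zero.1 this).symm

/-- A pure state `f` on a von Neumann algebra `M` is singular iff every increasing
approximate unit of `K_f = {x ∈ M : f (x x* + x* x) = 0}` converges to `1` in the σ-weak
topology of `M`. -/
theorem pure_state_singular_iff_approximate_unit
    (M : VonNeumannAlgebra H) (f : ↥M →ₗ[ℂ] ℂ) (hf : IsPureStateOn M f) :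
    IsSingularOn M f ↔
      ∀ (ι : Type*) [Preorder ι] [Nonempty ι] [IsDirected ι (· ≤ ·)] (e : ι → ↥M),
        -- `(e i)` is a net of positive elements of `K_f` of norm at most `1`
        (∀ i, f (e i * star (e i) + star (e i) * e i) = 0) →
        (∀ i, IsPositiveOp ((e i : H →L[ℂ] H))) →
        (∀ i, ‖(e i : H →L[ℂ] H)‖ ≤ 1) →
        -- increasing
        (∀ i j, i ≤ j → IsPositiveOp ((e j : H →L[ℂ] H) - (e i : H →L[ℂ] H))) →
        -- approximate unit for `K_f`
        (∀ a : ↥M, f (a * star a + star a * a) = 0 →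
          Tendsto (fun i => ‖(e i : H →L[ℂ] H) * a - (a : H →L[ℂ] H)‖) atTop (𝓝 0) ∧
          Tendsto (fun i => ‖(a : H →L[ℂ] H) * e i - (a : H →L[ℂ] H)‖) atTop (𝓝 0)) →
        -- converges to `1` σ-weakly
        Tendsto (fun i => (e i : H →L[ℂ] H)) atTop (@nhds _ (sigmaWeak H) 1) := by
  constructor
  · intro hsing ι _ _ _ e _ he0 he1 _ hea
    exact hsing.tendsto_one hf.1.1 (fun i => isPositiveOp_iff_nonneg.1 (he0 i)) he1
      fun a ha => (hea a ha).1
  · intro hunit g hg hfg hgn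
    obtain ⟨t, -, rfl⟩ := hf.2 g hg hfg
    by_cases ht : (t : ℂ) = 0
    · rw [ht, zero_smul]
    exfalso
    have hn : IsNormalOn M f := by
      have h : ⇑f = (fun z => (t : ℂ)⁻¹ * z) ∘ ⇑((t : ℂ) • f) := by
        ext x
        simp [ht]
      rw [IsNormalOn, h]
      exact @Continuous.comp _ _ _ (_) _ _ _ _ (continuous_const_mul _) hgn
    obtain ⟨h, h0, h1, hstar, hidem, hfh, hh⟩ := hn.exists_unit_of_kernel hf.1.1
    have hlim := hunit PUnit (fun _ => h) (fun _ => by rw [hstar, hidem, map_add, hfh, add_zero])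
      (fun _ => isPositiveOp_iff_nonneg.2 h0)
      (fun _ => ContinuousLinearMap.norm_le_one_of_nonneg_of_le_one h0 h1)
      (fun _ _ _ => by simp [isPositiveOp_iff_nonneg]) (fun a ha => by
        rw [map_add] at ha
        have ha' : f (star (star a) * star a) = 0 ∧ f (star a * a) = 0 := by
          rw [star_star]
          exact (add_eq_zero_iff_of_nonneg (by simpa using hf.1.1 (star a)) (hf.1.1 a)).1 ha
        have hright := hh a ha'.2
        have hleft : h * a = a := by
          simpa [hstar] using congrArg star (hh (star a) ha'.1)
        have hright' : (a : H →L[ℂ] H) * h = a := congrArg Subtype.val hright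
        have hleft' : (h : H →L[ℂ] H) * a = a := congrArg Subtype.val hleft
        simp [hright', hleft'])
    have hf1 := hn.tendsto_of_sigmaWeak (h := 1) hlim
    rw [hfh, hf.1.2] at hf1
    exact zero_ne_one (tendsto_nhds_unique tendsto_const_nhds hf1)
end
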